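/- For all real μ, ν, each i ∈ {1,2} and each j ∈ ℕ₀, the function Λ_{i,j}^{μ,ν} satisfies the fourth-order differential equation D_{μ,ν}Λ_{i,j}^{μ,ν}(x) = 4j(j+μ+1)·Λ_{i,j}^{μ,ν}(x) for all x > 0. -/

import Mathlib

noncomputable section

open Set MeasureTheory Filter Topology

/-- The Euler operator `θ = x·d/dx` acting on real-valued functions on `ℝ`. -/
def eulerOp (u : ℝ → ℝ) : ℝ → ℝ := fun x => x * deriv u x

/-- The operator `(θ + a)(θ + b) − x²` applied to `v`. -/
def quadOp (a b : ℝ) (v : ℝ → ℝ) : ℝ → ℝ := fun x =>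
  eulerOp (fun y => eulerOp v y + b * v y) x
    + a * (eulerOp v x + b * v x) - x ^ 2 * v x

/-- The fourth-order operator `D_{μ,ν} = x⁻²((θ+μ+ν)(θ+μ) − x²)(θ(θ+ν) − x²)`. -/
def Dop (μ ν : ℝ) (u : ℝ → ℝ) : ℝ → ℝ := fun x =>
  quadOp (μ + ν) μ (quadOp 0 ν u) x / x ^ 2

/-- The normalized I-Bessel function `Ĩ_α(z) = Σ (z/2)^{2n}/(n!·Γ(n+α+1))`. -/
def tildeI (α z : ℝ) : ℝ :=
  ∑' n : ℕ, (z / 2) ^ (2 * n) / ((n.factorial : ℝ) * Real.Gamma ((n : ℝ) + α + 1))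

/-- The K-Bessel function `K_α(z) = ∫₀^∞ e^{−z·cosh s}·cosh(α·s) ds`. -/
def besselK (α z : ℝ) : ℝ :=
  ∫ s in Ioi (0 : ℝ), Real.exp (-z * Real.cosh s) * Real.cosh (α * s)

/-- The normalized K-Bessel function `K̃_α(z) = (z/2)^{−α}·K_α(z)`. -/
def tildeK (α z : ℝ) : ℝ := (z / 2) ^ (-α) * besselK α z

/-- The generating function `G₁^{μ,ν}(t,x)`. -/
def genG₁ (μ ν t x : ℝ) : ℝ :=
  (1 - t) ^ (-(μ + ν + 2) / 2) * tildeI (μ / 2) (t * x / (1 - t)) * tildeI (ν / 2) (x / (1 - t))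

/-- The generating function `G₂^{μ,ν}(t,x)`. -/
def genG₂ (μ ν t x : ℝ) : ℝ :=
  (1 - t) ^ (-(μ + ν + 2) / 2) * tildeI (μ / 2) (t * x / (1 - t)) * tildeK (ν / 2) (x / (1 - t))

/-- The generating function `G₃^{μ,ν}(t,x)`. -/
def genG₃ (μ ν t x : ℝ) : ℝ :=
  (1 - t) ^ (-(μ + ν + 2) / 2) * tildeK (μ / 2) (t * x / (1 - t)) * tildeI (ν / 2) (x / (1 - t))

/-- The generating function `G₄^{μ,ν}(t,x)`. -/
def genG₄ (μ ν t x : ℝ) : ℝ :=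
  (1 - t) ^ (-(μ + ν + 2) / 2) * tildeK (μ / 2) (t * x / (1 - t)) * tildeK (ν / 2) (x / (1 - t))

/-- `Λ₁ⱼ^{μ,ν}(x) = (1/j!)·(∂/∂t)^j|₀ G₁^{μ,ν}(t,x)`. -/
def Lambda₁ (μ ν : ℝ) (j : ℕ) (x : ℝ) : ℝ :=
  iteratedDeriv j (fun t => genG₁ μ ν t x) 0 / (j.factorial : ℝ)

/-- `Λ₂ⱼ^{μ,ν}(x) = (1/j!)·(∂/∂t)^j|₀ G₂^{μ,ν}(t,x)`. -/
def Lambda₂ (μ ν : ℝ) (j : ℕ) (x : ℝ) : ℝ :=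
  iteratedDeriv j (fun t => genG₂ μ ν t x) 0 / (j.factorial : ℝ)

/-- `Λ₁ⱼ` for integer `j`, vanishing for `j < 0`. -/
def Lambda₁Z (μ ν : ℝ) (j : ℤ) (x : ℝ) : ℝ :=
  if 0 ≤ j then Lambda₁ μ ν j.toNat x else 0

/-- `Λ₂ⱼ` for integer `j`, vanishing for `j < 0`. -/
def Lambda₂Z (μ ν : ℝ) (j : ℤ) (x : ℝ) : ℝ :=
  if 0 ≤ j then Lambda₂ μ ν j.toNat x else 0

/-- For `μ = m` a positive odd integer, `Λ₃ⱼ^{μ,ν}(x) = (1/(j+μ)!)·(∂/∂t)^{j+μ}|₀ [tᵐ·G₃]`,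
the derivative at `0` being the limit from the right of the `(j+μ)`-th derivative of the
real-analytic function `t ↦ tᵐ·G₃^{m,ν}(t,x)` on `(0,1)`; it vanishes for `j < −μ`. -/
def Lambda₃ (m : ℕ) (ν : ℝ) (j : ℤ) (x : ℝ) : ℝ :=
  if -(m : ℤ) ≤ j then
    limUnder (𝓝[>] (0 : ℝ))
        (fun t => iteratedDeriv (j + (m : ℤ)).toNat (fun s => s ^ m * genG₃ (m : ℝ) ν s x) t) /
      (((j + (m : ℤ)).toNat.factorial : ℝ))
  else 0

/-- For `μ = m` a positive odd integer, `Λ₄ⱼ^{μ,ν}(x) = (1/(j+μ)!)·(∂/∂t)^{j+μ}|₀ [tᵐ·G₄]`,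
vanishing for `j < −μ`. -/
def Lambda₄ (m : ℕ) (ν : ℝ) (j : ℤ) (x : ℝ) : ℝ :=
  if -(m : ℤ) ≤ j then
    limUnder (𝓝[>] (0 : ℝ))
        (fun t => iteratedDeriv (j + (m : ℤ)).toNat (fun s => s ^ m * genG₄ (m : ℝ) ν s x) t) /
      (((j + (m : ℤ)).toNat.factorial : ℝ))
  else 0

open scoped ContDiff

/-- The region `t < 1`, `x > 0` on which the generating functions are smooth. -/
def genDomain : Set (ℝ × ℝ) := Iio 1 ×ˢ Ioi 0

theorem mem_genDomain {t x : ℝ} (ht : t < 1) (hx : 0 < x) : (t, x) ∈ genDomain :=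
  ⟨ht, hx⟩

theorem isOpen_genDomain : IsOpen genDomain := isOpen_Iio.prod isOpen_Ioi

/-- Smoothness of a function of `(t, x)` on `genDomain`. -/
def GenSmooth (F : ℝ → ℝ → ℝ) : Prop :=
  ContDiffOn ℝ ∞ (fun p : ℝ × ℝ => F p.1 p.2) genDomain

/-- The partial derivative in the first variable. -/
def partialT (F : ℝ → ℝ → ℝ) : ℝ → ℝ → ℝ := fun t x => deriv (fun s => F s x) t

/-- The partial derivative in the second variable. -/
def partialX (F : ℝ → ℝ → ℝ) : ℝ → ℝ → ℝ := fun t x => deriv (F t) x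

namespace GenSmooth

variable {F G : ℝ → ℝ → ℝ} {t x : ℝ}

theorem contDiffAt (hF : GenSmooth F) (ht : t < 1) (hx : 0 < x) :
    ContDiffAt ℝ ∞ (fun p : ℝ × ℝ => F p.1 p.2) (t, x) :=
  ContDiffOn.contDiffAt hF (isOpen_genDomain.mem_nhds (mem_genDomain ht hx))

theorem slice_left (hF : GenSmooth F) (hx : 0 < x) :
    ContDiffOn ℝ ∞ (fun t => F t x) (Iio 1) :=
  hF.comp (t := genDomain) (g := fun p : ℝ × ℝ => F p.1 p.2) (f := fun t => (t, x))
    (by fun_prop) (fun _ ht => ⟨ht, hx⟩)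

theorem partialT_eq (hF : GenSmooth F) (ht : t < 1) (hx : 0 < x) :
    partialT F t x = fderiv ℝ (fun p : ℝ × ℝ => F p.1 p.2) (t, x) (1, 0) := by
  have h := ((hF.contDiffAt ht hx).differentiableAt (by simp)).hasFDerivAt
  exact (h.comp_hasDerivAt t ((hasDerivAt_id t).prodMk (hasDerivAt_const t x))).deriv

theorem partialX_eq (hF : GenSmooth F) (ht : t < 1) (hx : 0 < x) :
    partialX F t x = fderiv ℝ (fun p : ℝ × ℝ => F p.1 p.2) (t, x) (0, 1) := by
  have h := ((hF.contDiffAt ht hx).differentiableAt (by simp)).hasFDerivAt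
  exact (h.comp_hasDerivAt x ((hasDerivAt_const x t).prodMk (hasDerivAt_id x))).deriv

theorem partialT (hF : GenSmooth F) : GenSmooth (partialT F) :=
  ((ContDiffOn.fderiv_of_isOpen hF isOpen_genDomain (m := ∞) (by simp)).clm_apply
    (contDiffOn_const (c := ((1 : ℝ), (0 : ℝ))))).congr
      fun p hp => hF.partialT_eq hp.1 hp.2

theorem partialX (hF : GenSmooth F) : GenSmooth (partialX F) :=
  ((ContDiffOn.fderiv_of_isOpen hF isOpen_genDomain (m := ∞) (by simp)).clm_apply
    (contDiffOn_const (c := ((0 : ℝ), (1 : ℝ))))).congr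
      fun p hp => hF.partialX_eq hp.1 hp.2

theorem partial_comm (hF : GenSmooth F) (ht : t < 1) (hx : 0 < x) :
    _root_.partialX (_root_.partialT F) t x = _root_.partialT (_root_.partialX F) t x := by
  have hd : DifferentiableAt ℝ (fderiv ℝ fun p : ℝ × ℝ => F p.1 p.2) (t, x) :=
    ((hF.contDiffAt ht hx).fderiv_right (m := ∞) (by simp)).differentiableAt (by simp)
  have key : ∀ v : ℝ × ℝ, ∀ H : ℝ → ℝ → ℝ,
      (∀ p ∈ genDomain, H p.1 p.2 = fderiv ℝ (fun p : ℝ × ℝ => F p.1 p.2) p v) →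
      fderiv ℝ (fun p : ℝ × ℝ => H p.1 p.2) (t, x) =
        (fderiv ℝ (fderiv ℝ fun p : ℝ × ℝ => F p.1 p.2) (t, x)).flip v := by
    intro v H hH
    rw [(Filter.eventuallyEq_of_mem (isOpen_genDomain.mem_nhds (mem_genDomain ht hx)) hH).fderiv_eq]
    ext <;> simp [fderiv_clm_apply hd]
  rw [hF.partialT.partialX_eq ht hx, hF.partialX.partialT_eq ht hx,
    key (1, 0) _ fun p hp => hF.partialT_eq hp.1 hp.2,
    key (0, 1) _ fun p hp => hF.partialX_eq hp.1 hp.2]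
  exact ((hF.contDiffAt ht hx).isSymmSndFDerivAt (n := ∞)
    (by simpa using ENat.LEInfty.out)) (0, 1) (1, 0)

theorem add (hF : GenSmooth F) (hG : GenSmooth G) : GenSmooth fun t x => F t x + G t x :=
  ContDiffOn.add hF hG

theorem mul (hF : GenSmooth F) (hG : GenSmooth G) : GenSmooth fun t x => F t x * G t x :=
  ContDiffOn.mul hF hG

theorem right {c : ℝ → ℝ} (hc : ContDiff ℝ ∞ c) : GenSmooth fun _ x => c x :=
  (hc.comp contDiff_snd).contDiffOn

theorem left {c : ℝ → ℝ} (hc : ContDiff ℝ ∞ c) : GenSmooth fun t _ => c t :=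
  (hc.comp contDiff_fst).contDiffOn

theorem eulerOp (hF : GenSmooth F) : GenSmooth fun t => eulerOp (F t) :=
  (right contDiff_id).mul hF.partialX

theorem eulerOp_add_const (hF : GenSmooth F) (b : ℝ) :
    GenSmooth fun t x => _root_.eulerOp (F t) x + b * F t x :=
  hF.eulerOp.add ((right contDiff_const).mul hF)

theorem quadOp (hF : GenSmooth F) (a b : ℝ) : GenSmooth fun t => quadOp a b (F t) := by
  have h := ((hF.eulerOp_add_const b).eulerOp_add_const a).add
    ((right (c := fun x => -x ^ 2) (by fun_prop)).mul hF)
  refine h.congr fun p _ => ?_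
  simp only [_root_.quadOp]
  ring

end GenSmooth

/-- The `j`-th `t`-derivative at `t = 0`. -/
def jetT (j : ℕ) (F : ℝ → ℝ → ℝ) : ℝ → ℝ := fun x => iteratedDeriv j (fun t => F t x) 0

variable {F G : ℝ → ℝ → ℝ} {x : ℝ}

theorem GenSmooth.contDiffAt_zero (hF : GenSmooth F) (hx : 0 < x) (n : ℕ) :
    ContDiffAt ℝ n (fun t => F t x) 0 :=
  ((hF.slice_left hx).contDiffAt (Iio_mem_nhds one_pos)).of_le (by exact_mod_cast le_top)

theorem jetT_add (j : ℕ) (hF : GenSmooth F) (hG : GenSmooth G) (hx : 0 < x) :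
    jetT j (fun t x => F t x + G t x) x = jetT j F x + jetT j G x :=
  iteratedDeriv_fun_add (hF.contDiffAt_zero hx j) (hG.contDiffAt_zero hx j)

theorem jetT_mul_left (j : ℕ) (c : ℝ → ℝ) (F : ℝ → ℝ → ℝ) (x : ℝ) :
    jetT j (fun t x => c x * F t x) x = c x * jetT j F x :=
  iteratedDeriv_const_mul_field (c x) (fun t => F t x)

theorem jetT_congr (j : ℕ) (h : ∀ t < 1, F t x = G t x) : jetT j F x = jetT j G x :=
  (Filter.eventuallyEq_of_mem (Iio_mem_nhds one_pos) h).iteratedDeriv_eq j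

theorem jetT_succ (j : ℕ) (F : ℝ → ℝ → ℝ) : jetT (j + 1) F = jetT j (partialT F) := by
  ext x
  simp only [jetT, iteratedDeriv_succ']
  rfl

theorem eulerOp_congr {u v : ℝ → ℝ} (h : ∀ y, 0 < y → u y = v y) (hx : 0 < x) :
    eulerOp u x = eulerOp v x := by
  simp only [eulerOp]
  rw [(Filter.eventuallyEq_of_mem (Ioi_mem_nhds hx) h).deriv_eq]

theorem quadOp_congr {u v : ℝ → ℝ} (a b : ℝ) (h : ∀ y, 0 < y → u y = v y) (hx : 0 < x) :
    quadOp a b u x = quadOp a b v x := by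
  have h1 : ∀ y, 0 < y → eulerOp u y = eulerOp v y := fun y hy => eulerOp_congr h hy
  simp only [quadOp]
  rw [h1 x hx, h x hx,
    eulerOp_congr (v := fun y => eulerOp v y + b * v y) (fun y hy => by rw [h1 y hy, h y hy]) hx]

theorem eulerOp_jetT (j : ℕ) (hF : GenSmooth F) (hx : 0 < x) :
    eulerOp (jetT j F) x = jetT j (fun t => eulerOp (F t)) x := by
  induction j generalizing F with
  | zero => rfl
  | succ j ih =>
    rw [jetT_succ, jetT_succ, ih hF.partialT]
    refine jetT_congr j fun t ht => ?_
    have h := hF.partial_comm ht hx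
    simp only [partialX, partialT, eulerOp] at h ⊢
    rw [h, deriv_const_mul_field]

theorem quadOp_jetT (j : ℕ) (a b : ℝ) (hF : GenSmooth F) (hx : 0 < x) :
    quadOp a b (jetT j F) x = jetT j (fun t => quadOp a b (F t)) x := by
  have h1 : ∀ {F : ℝ → ℝ → ℝ}, GenSmooth F → ∀ b : ℝ, ∀ y, 0 < y →
      eulerOp (jetT j F) y + b * jetT j F y =
        jetT j (fun t y => eulerOp (F t) y + b * F t y) y := by
    intro F hF b y hy
    rw [jetT_add j hF.eulerOp ((GenSmooth.right contDiff_const).mul hF) hy,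
      jetT_mul_left j (fun _ => b), eulerOp_jetT j hF hy]
  have hE := hF.eulerOp_add_const b
  have h2 : jetT j (fun t => quadOp a b (F t)) x = jetT j (fun t x =>
      (eulerOp (fun y => eulerOp (F t) y + b * F t y) x + a * (eulerOp (F t) x + b * F t x))
        + (-x ^ 2) * F t x) x :=
    jetT_congr j fun t _ => by simp only [quadOp]; ring
  rw [h2, jetT_add j (hE.eulerOp_add_const a)
      ((GenSmooth.right (c := fun x => -x ^ 2) (by fun_prop)).mul hF) hx,
    jetT_mul_left j (fun x => -x ^ 2), ← h1 hE a x hx, ← h1 hF b x hx]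
  simp only [quadOp]
  rw [eulerOp_congr (h1 hF b) hx]
  ring

theorem iteratedDeriv_eulerOp_zero {f : ℝ → ℝ} (hf : ContDiffOn ℝ ∞ f (Iio 1)) (j : ℕ) :
    iteratedDeriv j (eulerOp f) 0 = j * iteratedDeriv j f 0 := by
  induction j generalizing f with
  | zero => simp [eulerOp]
  | succ j ih =>
    have hf' : ContDiffOn ℝ ∞ (deriv f) (Iio 1) :=
      ((contDiffOn_infty_iff_deriv_of_isOpen isOpen_Iio).1 hf).2
    have hf'' : ContDiffOn ℝ ∞ (deriv (deriv f)) (Iio 1) :=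
      ((contDiffOn_infty_iff_deriv_of_isOpen isOpen_Iio).1 hf').2
    have hn : Iio (1 : ℝ) ∈ 𝓝 0 := Iio_mem_nhds one_pos
    have he : deriv (eulerOp f) =ᶠ[𝓝 0] fun t => deriv f t + eulerOp (deriv f) t := by
      filter_upwards [hn] with t ht
      have hd : HasDerivAt (deriv f) (deriv (deriv f) t) t :=
        ((hf'.contDiffAt (Iio_mem_nhds ht)).differentiableAt (by simp)).hasDerivAt
      have h := ((hasDerivAt_id t).mul hd).deriv
      rw [one_mul] at h
      exact h
    rw [iteratedDeriv_succ', iteratedDeriv_succ', he.iteratedDeriv_eq j, iteratedDeriv_fun_add,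
      ih hf']
    · push_cast; ring
    · exact (hf'.contDiffAt hn).of_le (by exact_mod_cast le_top)
    · exact ((contDiffOn_id.mul hf'').contDiffAt hn).of_le (by exact_mod_cast le_top)

/-- The entire function `Σ wⁿ / (n! Γ(n + α + 1))`. -/
def besselClifford (α w : ℝ) : ℝ :=
  ∑' n : ℕ, w ^ n / ((n.factorial : ℝ) * Real.Gamma ((n : ℝ) + α + 1))

theorem summable_besselClifford (α w : ℝ) :
    Summable fun n : ℕ => w ^ n / ((n.factorial : ℝ) * Real.Gamma ((n : ℝ) + α + 1)) := by
  refine summable_of_ratio_norm_eventually_le (r := 1 / 2) (by norm_num) ?_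
  have h1 : ∀ᶠ n : ℕ in atTop, (2 * |w| : ℝ) ≤ n := tendsto_natCast_atTop_atTop.eventually_ge_atTop _
  have h2 : ∀ᶠ n : ℕ in atTop, (-α : ℝ) ≤ n := tendsto_natCast_atTop_atTop.eventually_ge_atTop _
  filter_upwards [h1, h2] with n hn hα
  have e : Real.Gamma (((n + 1 : ℕ) : ℝ) + α + 1) =
      ((n : ℝ) + α + 1) * Real.Gamma ((n : ℝ) + α + 1) := by
    rw [← Real.Gamma_add_one (by linarith)]; push_cast; ring_nf
  have hq : (0 : ℝ) < (n + 1) * (n + α + 1) := mul_pos (by positivity) (by linarith)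
  have eq : w ^ (n + 1) / (((n + 1).factorial : ℝ) * Real.Gamma (((n + 1 : ℕ) : ℝ) + α + 1)) =
      w / ((n + 1) * (n + α + 1)) * (w ^ n / (n.factorial * Real.Gamma (n + α + 1))) := by
    rw [e, Nat.factorial_succ]
    push_cast
    have : (n : ℝ) + α + 1 ≠ 0 := by linarith
    field_simp
    ring
  rw [eq, norm_mul]
  refine mul_le_mul_of_nonneg_right ?_ (norm_nonneg _)
  rw [norm_div, Real.norm_eq_abs, Real.norm_of_nonneg hq.le, div_le_div_iff₀ hq two_pos]
  nlinarith [abs_nonneg w]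

theorem besselClifford_term_deriv (α w : ℝ) (n : ℕ) :
    ((n + 1 : ℕ) : ℝ) * w ^ n / (((n + 1).factorial : ℝ) * Real.Gamma (((n + 1 : ℕ) : ℝ) + α + 1))
      = w ^ n / ((n.factorial : ℝ) * Real.Gamma ((n : ℝ) + (α + 1) + 1)) := by
  have e : (((n + 1 : ℕ) : ℝ) + α + 1) = (n : ℝ) + (α + 1) + 1 := by push_cast; ring
  rw [e, Nat.factorial_succ, Nat.cast_mul, mul_assoc, mul_div_mul_left _ _ (by positivity)]

theorem hasDerivAt_besselClifford (α w : ℝ) :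
    HasDerivAt (besselClifford α) (besselClifford (α + 1) w) w := by
  set R := |w| + 1
  have hR : 0 ≤ R := by positivity
  have hsum (r : ℝ) : HasSum (fun n : ℕ => (n : ℝ) * r ^ (n - 1) /
      ((n.factorial : ℝ) * Real.Gamma ((n : ℝ) + α + 1))) (besselClifford (α + 1) r) := by
    rw [← hasSum_nat_add_iff' 1]
    simpa only [besselClifford, Nat.add_sub_cancel, besselClifford_term_deriv, Finset.sum_range_one,
      Nat.cast_zero, zero_mul, zero_div, sub_zero] using
        (summable_besselClifford (α + 1) r).hasSum
  have h := hasDerivAt_tsum_of_isPreconnected (𝕜 := ℝ) (t := Metric.ball 0 R) (y₀ := 0) (y := w)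
    (g := fun (n : ℕ) w => w ^ n / ((n.factorial : ℝ) * Real.Gamma ((n : ℝ) + α + 1)))
    (g' := fun (n : ℕ) w => (n : ℝ) * w ^ (n - 1) /
      ((n.factorial : ℝ) * Real.Gamma ((n : ℝ) + α + 1)))
    (hsum R).summable.abs Metric.isOpen_ball (convex_ball _ _).isPreconnected
    (fun n y _ => (hasDerivAt_pow n y).div_const _) ?_ (by simp [R]; positivity)
    (summable_besselClifford α 0) (by simp [R])
  · rwa [(hsum w).tsum_eq] at h
  · intro n y hy
    have hy' : |y| ≤ |R| := by
      rw [abs_of_nonneg hR]; simpa using (mem_ball_zero_iff.1 hy).le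
    simp only [Real.norm_eq_abs, abs_div, abs_mul, abs_pow]
    gcongr

theorem besselClifford_recurrence (α w : ℝ) :
    w * besselClifford (α + 2) w + (1 + α) * besselClifford (α + 1) w = besselClifford α w := by
  have h2 : HasSum (fun n : ℕ => n * (w ^ n / ((n.factorial : ℝ) *
      Real.Gamma ((n : ℝ) + (α + 1) + 1)))) (w * besselClifford (α + 2) w) := by
    rw [← hasSum_nat_add_iff' 1]
    simp only [Finset.sum_range_one, Nat.cast_zero, zero_mul, sub_zero]
    refine ((summable_besselClifford (α + 2) w).hasSum.mul_left w).congr_fun fun n => ?_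
    have h := besselClifford_term_deriv (α + 1) w n
    rw [add_assoc α, one_add_one_eq_two] at h
    rw [← h]
    ring
  have h1 := (summable_besselClifford (α + 1) w).hasSum.mul_left (1 + α)
  refine (h2.add h1).unique ((summable_besselClifford α w).hasSum.congr_fun fun n => ?_)
  have hG : (n + α + 1) / Real.Gamma (n + (α + 1) + 1) = 1 / Real.Gamma (n + α + 1) := by
    rcases eq_or_ne ((n : ℝ) + α + 1) 0 with h | h
    · simp [h, Real.Gamma_zero]
    · rw [← add_assoc, Real.Gamma_add_one h]
      field_simp
  calc _ = w ^ n / n.factorial * ((n + α + 1) / Real.Gamma (n + (α + 1) + 1)) := by ring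
    _ = _ := by rw [hG]; ring

theorem contDiff_besselClifford (α : ℝ) : ContDiff ℝ ∞ (besselClifford α) := by
  have h (n : ℕ) : ∀ α : ℝ, ContDiff ℝ n (besselClifford α) := by
    induction n with
    | zero =>
      exact fun α => contDiff_zero.2 (continuous_iff_continuousAt.2
        fun w => (hasDerivAt_besselClifford α w).continuousAt)
    | succ n ih =>
      intro α
      rw [Nat.cast_succ, contDiff_succ_iff_deriv]
      refine ⟨fun w => (hasDerivAt_besselClifford α w).differentiableAt, by simp, ?_⟩
      rw [show deriv (besselClifford α) = besselClifford (α + 1) from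
        funext fun w => (hasDerivAt_besselClifford α w).deriv]
      exact ih _
  exact contDiff_infty.2 fun n => h n α

theorem tildeI_eq (α : ℝ) : tildeI α = fun z => besselClifford α ((z / 2) ^ 2) := by
  ext z
  simp only [tildeI, besselClifford, pow_mul]

theorem contDiff_tildeI (α : ℝ) : ContDiff ℝ ∞ (tildeI α) := by
  rw [tildeI_eq]
  exact (contDiff_besselClifford α).comp (by fun_prop)

theorem hasDerivAt_tildeI (α z : ℝ) :
    HasDerivAt (tildeI α) (z / 2 * tildeI (α + 1) z) z := by
  have h : HasDerivAt (fun z : ℝ => (z / 2) ^ 2) (z / 2) z :=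
    (((hasDerivAt_id z).div_const 2).pow 2).congr_deriv (by simp; ring)
  simp only [tildeI_eq]
  exact ((hasDerivAt_besselClifford α _).comp z h).congr_deriv (by ring)

/-- Bessel's equation `θ(θ + 2α)u = z²u` for `u = Ĩ_α`, divided by `z`. -/
theorem tildeI_ode (α z : ℝ) :
    z * deriv (deriv (tildeI α)) z + (1 + 2 * α) * deriv (tildeI α) z = z * tildeI α z := by
  have h1 (β : ℝ) : deriv (tildeI β) = fun z => z / 2 * tildeI (β + 1) z :=
    funext fun z => (hasDerivAt_tildeI β z).deriv
  have h2 : HasDerivAt (fun z => z / 2 * tildeI (α + 1) z)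
      (1 / 2 * tildeI (α + 1) z + z / 2 * (z / 2 * tildeI (α + 1 + 1) z)) z :=
    ((hasDerivAt_id z).div_const 2).mul (hasDerivAt_tildeI (α + 1) z)
  have h3 := besselClifford_recurrence α ((z / 2) ^ 2)
  rw [h1, h2.deriv]
  simp only [tildeI_eq, add_assoc, one_add_one_eq_two] at h3 ⊢
  linear_combination z * h3

/-- The integrand `e^{-z cosh s} (cosh s)^k cosh(αs)` of the `k`-th derivative of `±K_α`. -/
def besselKIntegrand (k : ℕ) (α z s : ℝ) : ℝ :=
  Real.exp (-z * Real.cosh s) * Real.cosh s ^ k * Real.cosh (α * s)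

/-- `∫₀^∞ e^{-z cosh s} (cosh s)^k cosh(αs) ds`, which is `(-1)^k` times the `k`-th derivative
of `K_α`. -/
def besselKMoment (k : ℕ) (α z : ℝ) : ℝ :=
  ∫ s in Ioi (0 : ℝ), besselKIntegrand k α z s

theorem besselKIntegrand_nonneg (k : ℕ) (α z s : ℝ) : 0 ≤ besselKIntegrand k α z s := by
  have h1 := Real.cosh_pos s
  have h2 := Real.cosh_pos (α * s)
  unfold besselKIntegrand
  positivity

theorem continuous_besselKIntegrand (k : ℕ) (α z : ℝ) :
    Continuous (besselKIntegrand k α z) := by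
  unfold besselKIntegrand
  fun_prop

theorem besselKIntegrand_anti (k : ℕ) (α s : ℝ) {y z : ℝ} (h : y ≤ z) :
    besselKIntegrand k α z s ≤ besselKIntegrand k α y s := by
  have h1 := Real.cosh_pos s
  have h2 := Real.cosh_pos (α * s)
  unfold besselKIntegrand
  gcongr

theorem cosh_le_exp_abs (s : ℝ) : Real.cosh s ≤ Real.exp |s| := by
  rw [← Real.cosh_abs, Real.cosh_eq]
  have : Real.exp (-|s|) ≤ Real.exp |s| := Real.exp_le_exp.2 (by linarith [abs_nonneg s])
  linarith

theorem exists_besselKIntegrand_le (k : ℕ) (α : ℝ) {z : ℝ} (hz : 0 < z) :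
    ∃ C : ℝ, 0 ≤ C ∧ ∀ s, 0 ≤ s → besselKIntegrand k α z s ≤ C * Real.exp (-s) := by
  obtain ⟨m, hm⟩ := exists_nat_ge (|α| + 1)
  refine ⟨(k + m).factorial / z ^ (k + m) * 2 ^ m, by positivity, fun s hs => ?_⟩
  have hc := Real.cosh_pos s
  have h1 : Real.exp (-z * Real.cosh s) * Real.cosh s ^ k ≤
      (k + m).factorial / z ^ (k + m) * (Real.cosh s ^ m)⁻¹ := by
    have h := Real.pow_div_factorial_le_exp (z * Real.cosh s) (by positivity) (k + m)
    rw [neg_mul, Real.exp_neg, inv_mul_le_iff₀ (Real.exp_pos _)]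
    calc Real.cosh s ^ k = (z * Real.cosh s) ^ (k + m) / (k + m).factorial *
          ((k + m).factorial / z ^ (k + m) * (Real.cosh s ^ m)⁻¹) := by
            rw [mul_pow, pow_add (Real.cosh s)]
            field_simp
      _ ≤ _ := mul_le_mul_of_nonneg_right h (by positivity)
  have h2 : (Real.cosh s ^ m)⁻¹ ≤ 2 ^ m * Real.exp (-(m * s)) := by
    rw [Real.exp_neg, Real.exp_nat_mul, ← inv_pow, ← inv_pow, ← mul_pow]
    refine pow_le_pow_left₀ (by positivity) ?_ m
    rw [← div_eq_mul_inv, ← inv_div]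
    refine inv_anti₀ (by positivity) ?_
    rw [Real.cosh_eq]
    linarith [Real.exp_pos (-s)]
  have h3 : Real.cosh (α * s) ≤ Real.exp ((m - 1) * s) := by
    refine (cosh_le_exp_abs _).trans (Real.exp_le_exp.2 ?_)
    rw [abs_mul, abs_of_nonneg hs]
    gcongr
    linarith
  calc besselKIntegrand k α z s
      ≤ (k + m).factorial / z ^ (k + m) * (2 ^ m * Real.exp (-(m * s))) *
          Real.exp ((m - 1) * s) := by
        unfold besselKIntegrand
        refine mul_le_mul (h1.trans ?_) h3 (Real.cosh_pos _).le (by positivity)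
        gcongr
    _ = _ := by
        have e : Real.exp (-s) = Real.exp (-(m * s)) * Real.exp ((m - 1) * s) := by
          rw [← Real.exp_add]; ring_nf
        rw [e]
        ring

theorem integrableOn_besselKIntegrand (k : ℕ) (α : ℝ) {z : ℝ} (hz : 0 < z) :
    IntegrableOn (besselKIntegrand k α z) (Ioi 0) := by
  obtain ⟨C, -, h⟩ := exists_besselKIntegrand_le k α hz
  refine Integrable.mono' ((integrableOn_exp_neg_Ioi 0).const_mul C)
    (continuous_besselKIntegrand k α z).aestronglyMeasurable ?_
  filter_upwards [ae_restrict_mem measurableSet_Ioi] with s hs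
  rw [Real.norm_of_nonneg (besselKIntegrand_nonneg k α z s)]
  exact h s (le_of_lt hs)

theorem tendsto_besselKIntegrand (k : ℕ) (α : ℝ) {z : ℝ} (hz : 0 < z) :
    Tendsto (besselKIntegrand k α z) atTop (𝓝 0) := by
  obtain ⟨C, -, h⟩ := exists_besselKIntegrand_le k α hz
  refine squeeze_zero' (Eventually.of_forall (besselKIntegrand_nonneg k α z))
    ((eventually_ge_atTop 0).mono h) ?_
  simpa using (Real.tendsto_exp_neg_atTop_nhds_zero).const_mul C

theorem hasDerivAt_besselKMoment (k : ℕ) (α : ℝ) {z : ℝ} (hz : 0 < z) :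
    HasDerivAt (besselKMoment k α) (-besselKMoment (k + 1) α z) z := by
  have h := (hasDerivAt_integral_of_dominated_loc_of_deriv_le (μ := volume.restrict (Ioi (0 : ℝ)))
    (F := besselKIntegrand k α) (F' := fun z s => -besselKIntegrand (k + 1) α z s)
    (bound := besselKIntegrand (k + 1) α (z / 2)) (s := Ioi (z / 2)) (x₀ := z)
    (Ioi_mem_nhds (by linarith))
    (Eventually.of_forall fun y => (continuous_besselKIntegrand k α y).aestronglyMeasurable)
    (integrableOn_besselKIntegrand k α hz)
    (continuous_besselKIntegrand (k + 1) α z).neg.aestronglyMeasurable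
    (Eventually.of_forall fun s y hy => ?_)
    (integrableOn_besselKIntegrand (k + 1) α (by linarith))
    (Eventually.of_forall fun s y hy => ?_)).2
  · rw [integral_neg] at h
    exact h
  · rw [norm_neg, Real.norm_of_nonneg (besselKIntegrand_nonneg _ _ _ _)]
    exact besselKIntegrand_anti _ _ _ (le_of_lt hy)
  · have h1 : HasDerivAt (fun y => -y * Real.cosh s) (-Real.cosh s) y := by
      simpa using (hasDerivAt_id y).neg.mul_const (Real.cosh s)
    refine ((h1.exp.mul_const (Real.cosh s ^ k)).mul_const (Real.cosh (α * s))).congr_deriv ?_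
    simp only [besselKIntegrand]
    ring

theorem besselK_eq (α : ℝ) : besselK α = besselKMoment 0 α := by
  ext z
  simp [besselK, besselKMoment, besselKIntegrand]

theorem contDiffOn_besselKMoment (k : ℕ) (α : ℝ) :
    ContDiffOn ℝ ∞ (besselKMoment k α) (Ioi 0) := by
  have h (n : ℕ) : ∀ k, ContDiffOn ℝ n (besselKMoment k α) (Ioi 0) := by
    induction n with
    | zero =>
      exact fun k => contDiffOn_zero.2 fun z hz =>
        (hasDerivAt_besselKMoment k α hz).continuousAt.continuousWithinAt
    | succ n ih =>
      intro k
      rw [Nat.cast_succ, contDiffOn_succ_iff_deriv_of_isOpen isOpen_Ioi]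
      refine ⟨fun z hz => (hasDerivAt_besselKMoment k α hz).differentiableAt.differentiableWithinAt,
        by simp, (ih (k + 1)).neg.congr fun z hz => (hasDerivAt_besselKMoment k α hz).deriv⟩
  exact contDiffOn_infty.2 fun n => h n k

/-- Bessel's modified equation for `K_α`. -/
theorem besselKMoment_ode (α : ℝ) {z : ℝ} (hz : 0 < z) :
    z ^ 2 * besselKMoment 2 α z - z * besselKMoment 1 α z
      - (z ^ 2 + α ^ 2) * besselKMoment 0 α z = 0 := by
  have i0 := (integrableOn_besselKIntegrand 0 α hz).const_mul (z ^ 2 + α ^ 2)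
  have i1 := (integrableOn_besselKIntegrand 1 α hz).const_mul z
  have i2 := (integrableOn_besselKIntegrand 2 α hz).const_mul (z ^ 2)
  set f : ℝ → ℝ := fun s => -(Real.exp (-z * Real.cosh s) *
    (z * Real.sinh s * Real.cosh (α * s) + α * Real.sinh (α * s))) with hf
  have hd : ∀ s ∈ Ici (0 : ℝ), HasDerivAt f (z ^ 2 * besselKIntegrand 2 α z s
      - z * besselKIntegrand 1 α z s - (z ^ 2 + α ^ 2) * besselKIntegrand 0 α z s) s := by
    intro s _
    have ha : HasDerivAt (fun s => α * s) α s := by simpa using (hasDerivAt_id s).const_mul α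
    have h1 := ((Real.hasDerivAt_cosh s).const_mul (-z)).exp
    have h2 := ((((Real.hasDerivAt_sinh s).const_mul z).mul ha.cosh).add (ha.sinh.const_mul α))
    refine (h1.mul h2).neg.congr_deriv ?_
    simp only [besselKIntegrand, Pi.add_apply, Pi.mul_apply]
    linear_combination z ^ 2 * Real.exp (-z * Real.cosh s) * Real.cosh (α * s) * Real.sinh_sq s
  have hlim : Tendsto f atTop (𝓝 0) := by
    have hb := ((tendsto_besselKIntegrand 1 α hz).const_mul (z + |α|))
    rw [mul_zero] at hb
    refine squeeze_zero_norm (fun s => ?_) hb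
    have hs : |Real.sinh s| ≤ Real.cosh s := by
      rw [abs_le]
      constructor <;> nlinarith [Real.cosh_add_sinh s, Real.cosh_sub_sinh s, Real.exp_pos s,
        Real.exp_pos (-s)]
    have hs' : |Real.sinh (α * s)| ≤ Real.cosh (α * s) := by
      rw [abs_le]
      constructor <;> nlinarith [Real.cosh_add_sinh (α * s), Real.cosh_sub_sinh (α * s),
        Real.exp_pos (α * s), Real.exp_pos (-(α * s))]
    have hc := Real.one_le_cosh s
    have hc' := Real.cosh_pos (α * s)
    have e : |z * Real.sinh s * Real.cosh (α * s) + α * Real.sinh (α * s)| ≤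
        (z + |α|) * (Real.cosh s * Real.cosh (α * s)) := by
      refine (abs_add_le _ _).trans ?_
      rw [abs_mul, abs_mul, abs_mul, abs_of_pos hz, abs_of_pos hc', add_mul, mul_assoc]
      gcongr
      exact hs'.trans (le_mul_of_one_le_left hc'.le hc)
    rw [hf, norm_neg, norm_mul, Real.norm_of_nonneg (Real.exp_pos _).le, Real.norm_eq_abs]
    calc _ ≤ _ := mul_le_mul_of_nonneg_left e (Real.exp_pos _).le
      _ = _ := by simp only [besselKIntegrand]; ring
  have h := integral_Ioi_of_hasDerivAt_of_tendsto' hd ((i2.sub i1).sub i0) hlim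
  rw [integral_sub (f := fun s => z ^ 2 * besselKIntegrand 2 α z s - z * besselKIntegrand 1 α z s)
    (i2.sub i1) i0, integral_sub i2 i1, integral_const_mul, integral_const_mul,
    integral_const_mul] at h
  simpa [hf, besselKMoment] using h

theorem contDiffOn_tildeK (α : ℝ) : ContDiffOn ℝ ∞ (tildeK α) (Ioi 0) := by
  unfold tildeK
  rw [besselK_eq]
  refine ContDiffOn.mul (fun z hz => ?_) (contDiffOn_besselKMoment 0 α)
  have hz : z / 2 ≠ 0 := (half_pos hz).ne'
  exact (ContDiffAt.rpow_const_of_ne (f := fun z : ℝ => z / 2) (by fun_prop) hz).contDiffWithinAt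

/-- Bessel's equation `θ(θ + 2α)u = z²u` for `u = K̃_α`, divided by `z`. -/
theorem tildeK_ode (α : ℝ) {z : ℝ} (hz : 0 < z) :
    z * deriv (deriv (tildeK α)) z + (1 + 2 * α) * deriv (tildeK α) z = z * tildeK α z := by
  have hp (β : ℝ) {z : ℝ} (hz : 0 < z) :
      HasDerivAt (fun z => (z / 2) ^ β) (β / 2 * (z / 2) ^ (β - 1)) z :=
    (((hasDerivAt_id z).div_const 2).rpow_const (Or.inl (half_pos hz).ne')).congr_deriv (by
      simp only [id]; ring)
  have hd1 : ∀ z, 0 < z → HasDerivAt (tildeK α)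
      (-α / 2 * (z / 2) ^ (-α - 1) * besselKMoment 0 α z
        + (z / 2) ^ (-α) * -besselKMoment 1 α z) z := by
    intro z hz
    unfold tildeK
    rw [besselK_eq]
    exact (hp (-α) hz).mul (hasDerivAt_besselKMoment 0 α hz)
  have hd2 := HasDerivAt.deriv (f := fun z => -α / 2 * (z / 2) ^ (-α - 1) * besselKMoment 0 α z
    + (z / 2) ^ (-α) * -besselKMoment 1 α z)
    ((((hp (-α - 1) hz).const_mul (-α / 2)).mul (hasDerivAt_besselKMoment 0 α hz)).add
      ((hp (-α) hz).mul (hasDerivAt_besselKMoment 1 α hz).neg))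
  rw [(Filter.eventuallyEq_of_mem (Ioi_mem_nhds hz) fun y hy => (hd1 y hy).deriv).deriv_eq,
    (hd1 z hz).deriv, hd2]
  have h := besselKMoment_ode α hz
  rw [Real.rpow_sub_one (half_pos hz).ne', Real.rpow_sub_one (half_pos hz).ne']
  have hz' := hz.ne'
  simp only [tildeK, besselK_eq, zero_add, one_add_one_eq_two]
  field_simp
  linear_combination h

/-- The Euler operator in the first variable. -/
def thetaT (F : ℝ → ℝ → ℝ) : ℝ → ℝ → ℝ := fun t x => eulerOp (fun s => F s x) t

theorem GenSmooth.thetaT (hF : GenSmooth F) : GenSmooth (thetaT F) :=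
  (GenSmooth.left contDiff_id).mul hF.partialT

theorem GenSmooth.thetaT_add_const (hF : GenSmooth F) (c : ℝ) :
    GenSmooth fun t x => _root_.thetaT F t x + c * F t x :=
  hF.thetaT.add ((GenSmooth.right contDiff_const).mul hF)

theorem jetT_thetaT (j : ℕ) (hF : GenSmooth F) (hx : 0 < x) :
    jetT j (thetaT F) x = j * jetT j F x :=
  iteratedDeriv_eulerOp_zero (hF.slice_left hx) j

theorem jetT_thetaT_add_const (j : ℕ) (c : ℝ) (hF : GenSmooth F) (hx : 0 < x) :
    jetT j (fun t x => thetaT F t x + c * F t x) x = (j + c) * jetT j F x := by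
  rw [jetT_add j hF.thetaT ((GenSmooth.right contDiff_const).mul hF) hx,
    jetT_mul_left j (fun _ => c), jetT_thetaT j hF hx]
  ring

theorem eulerOp_const_mul (c : ℝ) (u : ℝ → ℝ) :
    eulerOp (fun y => c * u y) = fun y => c * eulerOp u y := by
  ext y
  simp only [eulerOp, deriv_const_mul_field]
  ring

theorem quadOp_const_mul (a b c : ℝ) (u : ℝ → ℝ) :
    quadOp a b (fun y => c * u y) = fun y => c * quadOp a b u y := by
  ext y
  have h : (fun y => c * eulerOp u y + b * (c * u y)) =
      fun y => c * (eulerOp u y + b * u y) := by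
    ext y; ring
  simp only [quadOp, eulerOp_const_mul, h]
  ring

/-- If `D_{μ,ν}F = 4θ_t(θ_t + μ + 1)F`, then the Taylor coefficients of `F` in `t` at `0` are
eigenfunctions of `D_{μ,ν}`. -/
theorem Dop_jetT_div_factorial (μ ν : ℝ) (j : ℕ) (hF : GenSmooth F)
    (hpde : ∀ t < 1, ∀ x, 0 < x → quadOp (μ + ν) μ (quadOp 0 ν (F t)) x =
      4 * x ^ 2 * thetaT (fun t x => thetaT F t x + (μ + 1) * F t x) t x) (hx : 0 < x) :
    Dop μ ν (fun y => jetT j F y / j.factorial) x =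
      4 * j * (j + μ + 1) * (jetT j F x / j.factorial) := by
  have h1 : (fun y => jetT j F y / (j.factorial : ℝ)) =
      fun y => (j.factorial : ℝ)⁻¹ * jetT j F y := by
    ext y; rw [div_eq_inv_mul]
  have h2 : jetT j (fun t => quadOp (μ + ν) μ (quadOp 0 ν (F t))) x =
      4 * x ^ 2 * (j * ((j + (μ + 1)) * jetT j F x)) := by
    rw [jetT_congr (G := fun t x => 4 * x ^ 2 *
      thetaT (fun t x => thetaT F t x + (μ + 1) * F t x) t x) j fun t ht => hpde t ht x hx,
      jetT_mul_left j (fun x => 4 * x ^ 2),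
      jetT_thetaT j (hF.thetaT_add_const _) hx, jetT_thetaT_add_const j _ hF hx]
  unfold Dop
  rw [h1, quadOp_const_mul, quadOp_const_mul]
  beta_reduce
  rw [quadOp_congr (v := jetT j fun t => quadOp 0 ν (F t)) _ _ (fun y hy => quadOp_jetT j 0 ν hF hy) hx,
    quadOp_jetT j _ _ (hF.quadOp 0 ν) hx, h2]
  field_simp
  ring

/-- The combination `a·I·B + b·θI·B + c·I·θB + d·θI·θB` of products of two functions and their
Euler derivatives. -/
def eulerComb (I B : ℝ → ℝ) (s z a b c d : ℝ) : ℝ :=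
  a * I s * B z + b * eulerOp I s * B z + c * I s * eulerOp B z + d * eulerOp I s * eulerOp B z

/-- `B` is smooth at `z` and solves the Bessel equation `θ(θ + ν)B = z²B` (divided by `z`). -/
structure BesselAt (ν : ℝ) (B : ℝ → ℝ) (z : ℝ) : Prop where
  contDiffAt : ContDiffAt ℝ ∞ B z
  ode : z * deriv (deriv B) z + (1 + ν) * deriv B z = z * B z

variable {μ ν : ℝ} {I B : ℝ → ℝ}

namespace BesselAt

variable {z : ℝ}

theorem hasDerivAt (h : BesselAt ν B z) : HasDerivAt B (deriv B z) z :=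
  (h.contDiffAt.differentiableAt (by simp)).hasDerivAt

theorem hasDerivAt_eulerOp (h : BesselAt ν B z) :
    HasDerivAt (eulerOp B) (z * B z - ν * deriv B z) z := by
  have hd : HasDerivAt (deriv B) (deriv (deriv B) z) z := by
    have h' : ContDiffAt ℝ ∞ (fun z => fderiv ℝ B z 1) z :=
      (h.contDiffAt.fderiv_right (m := ∞) (by simp)).clm_apply contDiffAt_const
    simp only [fderiv_apply_one_eq_deriv] at h'
    exact (h'.differentiableAt (by simp)).hasDerivAt
  refine ((hasDerivAt_id z).mul hd).congr_deriv ?_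
  simp only [id]
  linear_combination h.ode

end BesselAt

theorem eulerOp_eulerComb {w s z a b c d : ℝ → ℝ} {w' s' z' a' b' c' d' γ σ τ p : ℝ}
    (hI : BesselAt μ I (s p)) (hB : BesselAt ν B (z p))
    (hw : HasDerivAt w w' p) (hs : HasDerivAt s s' p) (hz : HasDerivAt z z' p)
    (ha : HasDerivAt a a' p) (hb : HasDerivAt b b' p) (hc : HasDerivAt c c' p)
    (hd : HasDerivAt d d' p)
    (hw' : p * w' = γ * w p) (hs' : p * s' = σ * s p) (hz' : p * z' = τ * z p) :
    eulerOp (fun q => w q * eulerComb I B (s q) (z q) (a q) (b q) (c q) (d q)) p =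
      w p * eulerComb I B (s p) (z p)
        (p * a' + γ * a p + σ * s p ^ 2 * b p + τ * z p ^ 2 * c p)
        (p * b' + γ * b p + σ * (a p - μ * b p) + τ * z p ^ 2 * d p)
        (p * c' + γ * c p + σ * s p ^ 2 * d p + τ * (a p - ν * c p))
        (p * d' + γ * d p + σ * (c p - μ * d p) + τ * (b p - ν * d p)) := by
  have i0 := hI.hasDerivAt.comp p hs
  have i1 := hI.hasDerivAt_eulerOp.comp p hs
  have b0 := hB.hasDerivAt.comp p hz
  have b1 := hB.hasDerivAt_eulerOp.comp p hz
  have h := HasDerivAt.deriv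
    (f := fun q => w q * eulerComb I B (s q) (z q) (a q) (b q) (c q) (d q))
    (hw.mul (((((ha.mul i0).mul b0).add ((hb.mul i1).mul b0)).add ((hc.mul i0).mul b1)).add
      ((hd.mul i1).mul b1)))
  rw [eulerOp, h]
  simp only [eulerComb, eulerOp, Pi.mul_apply, Function.comp_apply]
  set i := I (s p)
  set di := deriv I (s p)
  set e := B (z p)
  set de := deriv B (z p)
  linear_combination
    (a p * i * e + b p * (s p * di) * e + c p * i * (z p * de) + d p * (s p * di) * (z p * de)) * hw'
    + w p * (a p * di * e + b p * (s p * i - μ * di) * e + c p * di * (z p * de)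
      + d p * (s p * i - μ * di) * (z p * de)) * hs'
    + w p * (a p * i * de + b p * (s p * di) * de + c p * i * (z p * e - ν * de)
      + d p * (s p * di) * (z p * e - ν * de)) * hz'

theorem eulerOp_eulerComb_right {t x : ℝ} (ht : t < 1) (hx : 0 < x)
    (w a a₂ b b₂ c c₂ d d₂ : ℝ)
    (hI : ∀ s, BesselAt μ I s) (hB : ∀ z, 0 < z → BesselAt ν B z) :
    eulerOp (fun y => w * eulerComb I B (t * (y / (1 - t))) (y / (1 - t))
        (a + a₂ * (y / (1 - t)) ^ 2) (b + b₂ * (y / (1 - t)) ^ 2)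
        (c + c₂ * (y / (1 - t)) ^ 2) (d + d₂ * (y / (1 - t)) ^ 2)) x =
      w * eulerComb I B (t * (x / (1 - t))) (x / (1 - t))
        (2 * a₂ * (x / (1 - t)) ^ 2 + (t * (x / (1 - t))) ^ 2 * (b + b₂ * (x / (1 - t)) ^ 2)
          + (x / (1 - t)) ^ 2 * (c + c₂ * (x / (1 - t)) ^ 2))
        (2 * b₂ * (x / (1 - t)) ^ 2 + (a + a₂ * (x / (1 - t)) ^ 2)
          - μ * (b + b₂ * (x / (1 - t)) ^ 2) + (x / (1 - t)) ^ 2 * (d + d₂ * (x / (1 - t)) ^ 2))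
        (2 * c₂ * (x / (1 - t)) ^ 2 + (t * (x / (1 - t))) ^ 2 * (d + d₂ * (x / (1 - t)) ^ 2)
          + (a + a₂ * (x / (1 - t)) ^ 2) - ν * (c + c₂ * (x / (1 - t)) ^ 2))
        (2 * d₂ * (x / (1 - t)) ^ 2 + (c + c₂ * (x / (1 - t)) ^ 2)
          + (b + b₂ * (x / (1 - t)) ^ 2) - (μ + ν) * (d + d₂ * (x / (1 - t)) ^ 2)) := by
  have hz : HasDerivAt (fun y => y / (1 - t)) (1 / (1 - t)) x := (hasDerivAt_id x).div_const _
  have hp (k k₂ : ℝ) : HasDerivAt (fun y => k + k₂ * (y / (1 - t)) ^ 2)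
      (k₂ * (2 * (x / (1 - t)) * (1 / (1 - t)))) x :=
    (((hz.pow 2).const_mul k₂).const_add k).congr_deriv (by norm_num)
  rw [eulerOp_eulerComb (w := fun _ => w) (z := fun y => y / (1 - t)) (γ := 0) (σ := 1) (τ := 1)
    (hI _) (hB _ (div_pos hx (sub_pos.2 ht))) (hasDerivAt_const x w) (hz.const_mul t) hz
    (hp a a₂) (hp b b₂) (hp c c₂) (hp d d₂) (by ring) (by ring) (by ring)]
  simp only [eulerComb]
  ring

/-- The common shape of the generating functions `G₁` and `G₂`. -/
def genProduct (μ ν : ℝ) (I B : ℝ → ℝ) (t x : ℝ) : ℝ :=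
  (1 - t) ^ (-(μ + ν + 2) / 2) * I (t * x / (1 - t)) * B (x / (1 - t))

theorem genProduct_eq_eulerComb (μ ν : ℝ) (I B : ℝ → ℝ) (t x : ℝ) :
    genProduct μ ν I B t x = (1 - t) ^ (-(μ + ν + 2) / 2) *
      eulerComb I B (t * (x / (1 - t))) (x / (1 - t)) 1 0 0 0 := by
  simp only [genProduct, eulerComb, mul_div_assoc]
  ring

theorem eulerOp_genProduct {t x : ℝ} (ht : t < 1) (hx : 0 < x)
    (hI : ∀ s, BesselAt μ I s) (hB : ∀ z, 0 < z → BesselAt ν B z) :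
    eulerOp (genProduct μ ν I B t) x = (1 - t) ^ (-(μ + ν + 2) / 2) *
      eulerComb I B (t * (x / (1 - t))) (x / (1 - t)) 0 1 1 0 := by
  have h := eulerOp_eulerComb_right ht hx ((1 - t) ^ (-(μ + ν + 2) / 2)) 1 0 0 0 0 0 0 0 hI hB
  rw [show genProduct μ ν I B t = _ from funext (genProduct_eq_eulerComb μ ν I B t)]
  simpa using h

theorem quadOp_genProduct {t x : ℝ} (ht : t < 1) (hx : 0 < x)
    (hI : ∀ s, BesselAt μ I s) (hB : ∀ z, 0 < z → BesselAt ν B z) :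
    quadOp 0 ν (genProduct μ ν I B t) x = (1 - t) ^ (-(μ + ν + 2) / 2) *
      eulerComb I B (t * (x / (1 - t))) (x / (1 - t)) (2 * t * (x / (1 - t)) ^ 2) (ν - μ) 0 2 := by
  have h := eulerOp_eulerComb_right ht hx ((1 - t) ^ (-(μ + ν + 2) / 2)) ν 0 1 0 1 0 0 0 hI hB
  rw [quadOp, eulerOp_congr (fun y hy => ?_) hx, h, genProduct_eq_eulerComb]
  · generalize (1 - t) ^ (-(μ + ν + 2) / 2) = w
    have hx' : x = x / (1 - t) * (1 - t) := (div_mul_cancel₀ x (sub_pos.2 ht).ne').symm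
    generalize x / (1 - t) = z at hx' ⊢
    subst hx'
    simp only [eulerComb]
    ring
  · rw [eulerOp_genProduct ht hy hI hB, genProduct_eq_eulerComb]
    simp only [eulerComb]
    ring

theorem quadOp_quadOp_genProduct {t x : ℝ} (ht : t < 1) (hx : 0 < x)
    (hI : ∀ s, BesselAt μ I s) (hB : ∀ z, 0 < z → BesselAt ν B z) :
    quadOp (μ + ν) μ (quadOp 0 ν (genProduct μ ν I B t)) x =
      4 * (x / (1 - t)) ^ 2 * ((1 - t) ^ (-(μ + ν + 2) / 2) *
        eulerComb I B (t * (x / (1 - t))) (x / (1 - t))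
          (2 * t ^ 2 * (x / (1 - t)) ^ 2
            + (μ + ν + 2) / 2 * ((μ + 2) * t + (ν - μ) / 2 * t ^ 2))
          (1 + (ν + 2) * t) ((μ + 2) * t + t ^ 2) (2 * t)) := by
  set w := (1 - t) ^ (-(μ + ν + 2) / 2) with hw
  have h1 := fun y (hy : 0 < y) =>
    eulerOp_eulerComb_right ht hy w 0 (2 * t) (ν - μ) 0 0 0 2 0 hI hB
  have h2 := eulerOp_eulerComb_right ht hx w 0 (4 * t + t ^ 2 * (ν - μ) + 2 * μ * t)
    0 (2 * t + 2) 0 (2 * t + 2 * t ^ 2) (-ν - μ) 0 hI hB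
  have h3 : ∀ y, 0 < y → eulerOp (quadOp 0 ν (genProduct μ ν I B t)) y
      + μ * quadOp 0 ν (genProduct μ ν I B t) y =
      w * eulerComb I B (t * (y / (1 - t))) (y / (1 - t))
        (0 + (4 * t + t ^ 2 * (ν - μ) + 2 * μ * t) * (y / (1 - t)) ^ 2)
        (0 + (2 * t + 2) * (y / (1 - t)) ^ 2) (0 + (2 * t + 2 * t ^ 2) * (y / (1 - t)) ^ 2)
        (-ν - μ + 0 * (y / (1 - t)) ^ 2) := by
    intro y hy
    rw [eulerOp_congr (fun y' hy' => ?_) hy, h1 y hy, quadOp_genProduct ht hy hI hB, ← hw]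
    · simp only [eulerComb]
      ring
    · rw [quadOp_genProduct ht hy' hI hB, ← hw]
      simp only [eulerComb]
      ring
  rw [quadOp, eulerOp_congr h3 hx, h2, h3 x hx, quadOp_genProduct ht hx hI hB, ← hw]
  have hx' : x = x / (1 - t) * (1 - t) := (div_mul_cancel₀ x (sub_pos.2 ht).ne').symm
  clear h1 h2 h3
  clear_value w
  generalize x / (1 - t) = z at hx' ⊢
  subst hx'
  simp only [eulerComb]
  ring

theorem eulerOp_eulerComb_left {t x : ℝ} (ht : t < 1) (hx : 0 < x) (γ : ℝ)
    {a b c d : ℝ → ℝ} {a' b' c' d' : ℝ} (hI : ∀ s, BesselAt μ I s)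
    (hB : ∀ z, 0 < z → BesselAt ν B z) (ha : HasDerivAt a a' t) (hb : HasDerivAt b b' t)
    (hc : HasDerivAt c c' t) (hd : HasDerivAt d d' t) :
    eulerOp (fun r => (1 - r) ^ (-γ) *
        eulerComb I B (r * (x / (1 - r))) (x / (1 - r)) (a r) (b r) (c r) (d r)) t =
      (1 - t) ^ (-γ) * eulerComb I B (t * (x / (1 - t))) (x / (1 - t))
        (t * a' + γ * t / (1 - t) * a t + 1 / (1 - t) * (t * (x / (1 - t))) ^ 2 * b t
          + t / (1 - t) * (x / (1 - t)) ^ 2 * c t)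
        (t * b' + γ * t / (1 - t) * b t + 1 / (1 - t) * (a t - μ * b t)
          + t / (1 - t) * (x / (1 - t)) ^ 2 * d t)
        (t * c' + γ * t / (1 - t) * c t + 1 / (1 - t) * (t * (x / (1 - t))) ^ 2 * d t
          + t / (1 - t) * (a t - ν * c t))
        (t * d' + γ * t / (1 - t) * d t + 1 / (1 - t) * (c t - μ * d t)
          + t / (1 - t) * (b t - ν * d t)) := by
  have h1 : 0 < 1 - t := sub_pos.2 ht
  have hsub : HasDerivAt (fun r : ℝ => 1 - r) (-1) t := by
    simpa using (hasDerivAt_id t).const_sub 1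
  have hz : HasDerivAt (fun r => x / (1 - r)) (x / (1 - t) ^ 2) t :=
    ((hasDerivAt_const t x).div hsub h1.ne').congr_deriv (by ring)
  have hw : HasDerivAt (fun r : ℝ => (1 - r) ^ (-γ)) (γ / (1 - t) * (1 - t) ^ (-γ)) t := by
    refine (hsub.rpow_const (Or.inl h1.ne')).congr_deriv ?_
    rw [Real.rpow_sub_one h1.ne']
    ring
  refine eulerOp_eulerComb (w := fun r => (1 - r) ^ (-γ)) (z := fun r => x / (1 - r))
    (s := fun r => r * (x / (1 - r))) (hI _) (hB _ (div_pos hx h1)) hw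
    ((hasDerivAt_id t).mul hz) hz ha hb hc hd (by ring) ?_ ?_
  · simp only [id]
    field_simp
    ring
  · field_simp

theorem thetaT_genProduct {t x : ℝ} (ht : t < 1) (hx : 0 < x)
    (hI : ∀ s, BesselAt μ I s) (hB : ∀ z, 0 < z → BesselAt ν B z) :
    thetaT (genProduct μ ν I B) t x = (1 - t) ^ (-((μ + ν + 2) / 2)) *
      eulerComb I B (t * (x / (1 - t))) (x / (1 - t))
        ((μ + ν + 2) / 2 * (t / (1 - t))) (1 / (1 - t)) (t / (1 - t)) 0 := by
  have h := eulerOp_eulerComb_left ht hx ((μ + ν + 2) / 2) hI hB (hasDerivAt_const t 1)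
    (hasDerivAt_const t 0) (hasDerivAt_const t 0) (hasDerivAt_const t 0)
  simp only [← neg_div, ← genProduct_eq_eulerComb] at h ⊢
  rw [thetaT, h]
  simp only [eulerComb]
  ring

theorem genProduct_pde {t x : ℝ} (ht : t < 1) (hx : 0 < x)
    (hI : ∀ s, BesselAt μ I s) (hB : ∀ z, 0 < z → BesselAt ν B z) :
    quadOp (μ + ν) μ (quadOp 0 ν (genProduct μ ν I B t)) x =
      4 * x ^ 2 * thetaT (fun t x => thetaT (genProduct μ ν I B) t x
        + (μ + 1) * genProduct μ ν I B t x) t x := by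
  have h1 : 0 < 1 - t := sub_pos.2 ht
  have hsub : HasDerivAt (fun r : ℝ => 1 - r) (-1) t := by
    simpa using (hasDerivAt_id t).const_sub 1
  have hσ : HasDerivAt (fun r : ℝ => 1 / (1 - r)) (1 / (1 - t) ^ 2) t :=
    ((hasDerivAt_const t (1 : ℝ)).div hsub h1.ne').congr_deriv (by ring)
  have hτ : HasDerivAt (fun r : ℝ => r / (1 - r)) (1 / (1 - t) ^ 2) t :=
    ((hasDerivAt_id t).div hsub h1.ne').congr_deriv (by simp only [id]; ring)
  have h := eulerOp_eulerComb_left ht hx ((μ + ν + 2) / 2) hI hB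
    ((hτ.const_mul ((μ + ν + 2) / 2)).add_const (μ + 1)) hσ hτ (hasDerivAt_const t 0)
  have hE : (fun r => thetaT (genProduct μ ν I B) r x + (μ + 1) * genProduct μ ν I B r x)
      =ᶠ[𝓝 t] fun r => (1 - r) ^ (-((μ + ν + 2) / 2)) *
        eulerComb I B (r * (x / (1 - r))) (x / (1 - r))
          ((μ + ν + 2) / 2 * (r / (1 - r)) + (μ + 1)) (1 / (1 - r)) (r / (1 - r)) 0 := by
    filter_upwards [Iio_mem_nhds ht] with r hr
    rw [thetaT_genProduct hr hx hI hB, genProduct_eq_eulerComb, neg_div]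
    simp only [eulerComb]
    ring
  rw [thetaT, eulerOp, hE.deriv_eq, ← eulerOp, h, quadOp_quadOp_genProduct ht hx hI hB, neg_div]
  generalize (1 - t) ^ (-((μ + ν + 2) / 2)) = w
  have hx' : x = x / (1 - t) * (1 - t) := (div_mul_cancel₀ x h1.ne').symm
  generalize x / (1 - t) = z at hx' ⊢
  subst hx'
  simp only [eulerComb]
  generalize I (t * z) = i
  generalize eulerOp I (t * z) = di
  field_simp
  ring

theorem genSmooth_genProduct (hI : ∀ s, BesselAt μ I s) (hB : ∀ z, 0 < z → BesselAt ν B z) :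
    GenSmooth (genProduct μ ν I B) := by
  rintro ⟨t, x⟩ ⟨ht, hx⟩
  have h1 : 1 - t ≠ 0 := (sub_pos.2 ht).ne'
  refine ContDiffAt.contDiffWithinAt ((ContDiffAt.mul ?_ ?_).mul ?_)
  · exact ContDiffAt.rpow_const_of_ne (f := fun p : ℝ × ℝ => 1 - p.1) (by fun_prop) h1
  · exact (hI _).contDiffAt.comp (f := fun p : ℝ × ℝ => p.1 * p.2 / (1 - p.1)) (t, x)
      (by fun_prop (disch := exact h1))
  · exact (hB _ (div_pos hx (sub_pos.2 ht))).contDiffAt.comp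
      (f := fun p : ℝ × ℝ => p.2 / (1 - p.1)) (t, x) (by fun_prop (disch := exact h1))

theorem besselAt_tildeI (μ s : ℝ) : BesselAt μ (tildeI (μ / 2)) s where
  contDiffAt := (contDiff_tildeI _).contDiffAt
  ode := by linear_combination tildeI_ode (μ / 2) s

theorem besselAt_tildeK (ν : ℝ) {z : ℝ} (hz : 0 < z) : BesselAt ν (tildeK (ν / 2)) z where
  contDiffAt := (contDiffOn_tildeK _).contDiffAt (Ioi_mem_nhds hz)
  ode := by linear_combination tildeK_ode (ν / 2) hz

/-- For all real `μ, ν`, `i ∈ {1,2}` and `j ∈ ℕ₀`, the function `Λ_{i,j}^{μ,ν}` satisfies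
`D_{μ,ν} Λ_{i,j}^{μ,ν} = 4j(j+μ+1)·Λ_{i,j}^{μ,ν}` on `(0,∞)`. -/
theorem statement4 (μ ν : ℝ) (j : ℕ) (x : ℝ) (hx : 0 < x) :
    Dop μ ν (fun y => Lambda₁ μ ν j y) x
      = 4 * (j : ℝ) * ((j : ℝ) + μ + 1) * Lambda₁ μ ν j x ∧
    Dop μ ν (fun y => Lambda₂ μ ν j y) x
      = 4 * (j : ℝ) * ((j : ℝ) + μ + 1) * Lambda₂ μ ν j x := by
  have hI := besselAt_tildeI μ
  have hB₁ := fun z (_ : 0 < z) => besselAt_tildeI ν z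
  have hB₂ := fun z (hz : 0 < z) => besselAt_tildeK ν hz
  exact ⟨Dop_jetT_div_factorial μ ν j (genSmooth_genProduct hI hB₁)
      (fun _ ht _ hx => genProduct_pde ht hx hI hB₁) hx,
    Dop_jetT_div_factorial μ ν j (genSmooth_genProduct hI hB₂)
      (fun _ ht _ hx => genProduct_pde ht hx hI hB₂) hx⟩
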